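/- arXiv:1709.02695 — 3 statements merged into one kernel-verified Lean document; each statement's English description precedes it below -/
import Mathlib

section
/- Suppose p is a probability density on Θ solving the Fredholm equation f(x) = ∫_Θ k(x,θ) p(θ) dθ, and let (p_m) be generated by the iterative scheme from an initial probability density p₀ > 0 on Θ with D(p, p₀) < ∞. Then the mixtures f_m(x) = ∫_Θ k(x,θ) p_m(θ) dθ converge to f in L¹, i.e. ∫_𝕏 |f_m(x) − f(x)| dx → 0 as m → ∞. -/
open MeasureTheory Real Filter Set

noncomputable def mix (Θ : Set ℝ) (k : ℝ → ℝ → ℝ) (p : ℝ → ℝ) (x : ℝ) : ℝ :=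
  ∫ θ in Θ, k x θ * p θ

noncomputable def KL (S : Set ℝ) (g h : ℝ → ℝ) : ℝ :=
  ∫ y in S, g y * Real.log (g y / h y)

/-- `q` is a probability density with respect to `ν` (in the almost everywhere sense) that is
positive almost everywhere where `g` is. -/
structure IsDensityDominating {β : Type*} [MeasurableSpace β] (ν : Measure β) (g q : β → ℝ) :
    Prop where
  measurable : Measurable q
  nonneg : ∀ᵐ θ ∂ν, 0 ≤ q θ
  integrable : Integrable q ν
  integral_eq_one : ∫ θ, q θ ∂ν = 1
  pos_of_pos : ∀ᵐ θ ∂ν, 0 < g θ → 0 < q θ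

theorem two_mul_one_sub_inv_sqrt_le_log {r : ℝ} (hr : 0 < r) : 2 * (1 - (√r)⁻¹) ≤ log r := by
  have h := Real.one_sub_inv_le_log_of_pos (Real.sqrt_pos.2 hr)
  rw [Real.log_sqrt hr.le] at h
  linarith

/-- The tangent line inequality for the convex function `u ↦ 1 / √u`. -/
theorem inv_sqrt_tangent_le {r u : ℝ} (hr : 0 < r) (hu : 0 < u) :
    (√r)⁻¹ - (u - r) / (2 * √r ^ 3) ≤ √(u⁻¹) := by
  have ha := Real.sqrt_pos.2 hu
  have hb := Real.sqrt_pos.2 hr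
  have hu2 := Real.sq_sqrt hu.le
  have hr2 := Real.sq_sqrt hr.le
  rw [Real.sqrt_inv]
  generalize √u = a at *
  generalize √r = b at *
  subst hu2 hr2
  have key : a⁻¹ - (b⁻¹ - (a ^ 2 - b ^ 2) / (2 * b ^ 3))
      = (a - b) ^ 2 * (a + 2 * b) / (2 * a * b ^ 3) := by
    field_simp
    ring
  have : 0 ≤ (a - b) ^ 2 * (a + 2 * b) / (2 * a * b ^ 3) := by positivity
  linarith

theorem abs_sub_le_sq_sqrt_sub_sqrt {a b ε : ℝ} (ha : 0 ≤ a) (hb : 0 ≤ b) (hε : 0 < ε) :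
    |a - b| ≤ (a + b - 2 * √(b * a)) / (2 * ε) + ε * (a + b) := by
  have ha2 := Real.sq_sqrt ha
  have hb2 := Real.sq_sqrt hb
  have hsa := Real.sqrt_nonneg a
  have hsb := Real.sqrt_nonneg b
  rw [Real.sqrt_mul hb]
  generalize √a = s at *
  generalize √b = t at *
  subst ha2 hb2
  have e : (s ^ 2 + t ^ 2 - 2 * (t * s)) / (2 * ε) + ε * (s ^ 2 + t ^ 2) - |s - t| * (s + t)
      = ((|s - t| - ε * (s + t)) ^ 2 + ε ^ 2 * (s - t) ^ 2) / (2 * ε) := by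
    have h := sq_abs (s - t)
    field_simp
    linear_combination (-1) * h
  have h0 : 0 ≤ ((|s - t| - ε * (s + t)) ^ 2 + ε ^ 2 * (s - t) ^ 2) / (2 * ε) := by positivity
  have : |s ^ 2 - t ^ 2| = |s - t| * (s + t) := by
    rw [sq_sub_sq, abs_mul, abs_of_nonneg (add_nonneg hsa hsb), mul_comm]
  linarith

/-- A Jensen type bound for the logarithm of the mean of `u` under the density `κ`. -/
theorem log_integral_mul_ge {α : Type*} [MeasurableSpace α] {μ : Measure α} {κ u : α → ℝ}
    (hκ : ∀ x, 0 ≤ κ x) (hκ1 : ∫ x, κ x ∂μ = 1) (hu : ∀ᵐ x ∂μ, 0 ≤ u x)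
    (hu0 : ∀ᵐ x ∂μ, u x = 0 → κ x = 0) (hi : Integrable (fun x => κ x * u x) μ)
    (hs : Integrable (fun x => κ x * √((u x)⁻¹)) μ) :
    0 < ∫ x, κ x * u x ∂μ ∧
      2 * (1 - ∫ x, κ x * √((u x)⁻¹) ∂μ) ≤ log (∫ x, κ x * u x ∂μ) := by
  have hκi : Integrable κ μ := by
    by_contra h
    rw [integral_undef h] at hκ1
    exact zero_ne_one hκ1
  have hnn : 0 ≤ᵐ[μ] fun x => κ x * u x := by
    filter_upwards [hu] with x hx using mul_nonneg (hκ x) hx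
  have hr : 0 < ∫ x, κ x * u x ∂μ := by
    refine lt_of_le_of_ne (integral_nonneg_of_ae hnn) fun h0 => ?_
    have h1 := (integral_eq_zero_iff_of_nonneg_ae hnn hi).1 h0.symm
    have h2 : κ =ᵐ[μ] 0 := by
      filter_upwards [h1, hu0] with x hx hx0
      rcases mul_eq_zero.1 hx with h | h
      · exact h
      · exact hx0 h
    rw [integral_congr_ae h2] at hκ1
    simp at hκ1
  refine ⟨hr, ?_⟩
  set r := ∫ x, κ x * u x ∂μ with hrdef
  refine le_trans ?_ (two_mul_one_sub_inv_sqrt_le_log hr)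
  have hle : ∫ x, (κ x * ((√r)⁻¹ + r / (2 * √r ^ 3)) - κ x * u x / (2 * √r ^ 3)) ∂μ
      ≤ ∫ x, κ x * √((u x)⁻¹) ∂μ := by
    refine integral_mono_ae ((hκi.mul_const _).sub (hi.div_const _)) hs ?_
    filter_upwards [hu, hu0] with x hx hx0
    rcases hx.eq_or_lt with h | h
    · simp [hx0 h.symm]
    · have := mul_le_mul_of_nonneg_left (inv_sqrt_tangent_le hr h) (hκ x)
      refine le_trans (le_of_eq ?_) this
      ring
  rw [integral_sub (hκi.mul_const _) (hi.div_const _), integral_mul_const, integral_div, hκ1,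
    ← hrdef] at hle
  linarith

section Hellinger

variable {α : Type*} [MeasurableSpace α] {μ : Measure α} {f h : α → ℝ}

theorem integrable_sqrt_mul (hfm : Measurable f) (hhm : Measurable h) (hf0 : ∀ᵐ x ∂μ, 0 ≤ f x)
    (hh0 : ∀ᵐ x ∂μ, 0 ≤ h x) (hfi : Integrable f μ) (hhi : Integrable h μ) :
    Integrable (fun x => √(f x * h x)) μ := by
  refine (hfi.add hhi).mono' (hfm.mul hhm).sqrt.aestronglyMeasurable ?_
  filter_upwards [hf0, hh0] with x hfx hhx
  rw [Real.norm_of_nonneg (Real.sqrt_nonneg _)]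
  refine Real.sqrt_le_iff.2 ⟨add_nonneg hfx hhx, ?_⟩
  simp only [Pi.add_apply]
  nlinarith [mul_nonneg hfx hhx, sq_nonneg (f x), sq_nonneg (h x)]

theorem integral_sqrt_mul_le_one (hfm : Measurable f) (hhm : Measurable h)
    (hf0 : ∀ᵐ x ∂μ, 0 ≤ f x) (hh0 : ∀ᵐ x ∂μ, 0 ≤ h x) (hfi : Integrable f μ)
    (hhi : Integrable h μ) (hf1 : ∫ x, f x ∂μ = 1) (hh1 : ∫ x, h x ∂μ = 1) :
    ∫ x, √(f x * h x) ∂μ ≤ 1 := by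
  have hle : ∫ x, √(f x * h x) ∂μ ≤ ∫ x, (f x + h x) / 2 ∂μ := by
    refine integral_mono_ae (integrable_sqrt_mul hfm hhm hf0 hh0 hfi hhi)
      ((hfi.add hhi).div_const 2) ?_
    filter_upwards [hf0, hh0] with x hfx hhx
    refine Real.sqrt_le_iff.2 ⟨by positivity, ?_⟩
    nlinarith [sq_nonneg (f x - h x)]
  rw [integral_div, integral_add hfi hhi, hf1, hh1] at hle
  linarith

theorem integral_abs_sub_le_hellinger (hfm : Measurable f) (hhm : Measurable h)
    (hf0 : ∀ᵐ x ∂μ, 0 ≤ f x) (hh0 : ∀ᵐ x ∂μ, 0 ≤ h x) (hfi : Integrable f μ)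
    (hhi : Integrable h μ) (hf1 : ∫ x, f x ∂μ = 1) (hh1 : ∫ x, h x ∂μ = 1) {ε : ℝ}
    (hε : 0 < ε) :
    ∫ x, |h x - f x| ∂μ ≤ (2 - 2 * ∫ x, √(f x * h x) ∂μ) / (2 * ε) + 2 * ε := by
  have hS := integrable_sqrt_mul hfm hhm hf0 hh0 hfi hhi
  have hsum : Integrable (fun x => h x + f x) μ := hhi.add hfi
  have hsub : Integrable (fun x => (h x + f x - 2 * √(f x * h x)) / (2 * ε)) μ :=
    (hsum.sub (hS.const_mul 2)).div_const _
  have hle : ∫ x, |h x - f x| ∂μ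
      ≤ ∫ x, ((h x + f x - 2 * √(f x * h x)) / (2 * ε) + ε * (h x + f x)) ∂μ := by
    refine integral_mono_ae (hhi.sub hfi).abs (hsub.add (hsum.const_mul ε)) ?_
    filter_upwards [hf0, hh0] with x hfx hhx
    exact abs_sub_le_sq_sqrt_sub_sqrt hhx hfx hε
  rw [integral_add hsub (hsum.const_mul ε), integral_div, integral_sub hsum (hS.const_mul 2),
    integral_const_mul, integral_const_mul, integral_add hhi hfi, hf1, hh1] at hle
  refine hle.trans (le_of_eq ?_)
  ring

end Hellinger

theorem mixture_nonneg {α β : Type*} [MeasurableSpace β] {ν : Measure β} {k : α → β → ℝ}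
    {q : β → ℝ} (hk0 : ∀ x θ, 0 ≤ k x θ) (hq0 : ∀ᵐ θ ∂ν, 0 ≤ q θ) (x : α) :
    0 ≤ ∫ θ, k x θ * q θ ∂ν := by
  refine integral_nonneg_of_ae ?_
  filter_upwards [hq0] with θ hθ using mul_nonneg (hk0 x θ) hθ

/-- The summed squared Hellinger distances are bounded by the initial relative entropy. -/
theorem sum_hellinger_le {β : Type*} [MeasurableSpace β] {ν : Measure β} {g : β → ℝ}
    (hg0 : ∀ᵐ θ ∂ν, 0 ≤ g θ) (hgi : Integrable g ν)
    (hg1 : ∫ θ, g θ ∂ν = 1) {p G : ℕ → β → ℝ} {A : ℕ → ℝ}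
    (hp : ∀ m, IsDensityDominating ν g (p m))
    (hGi : ∀ m, Integrable (fun θ => g θ * G m θ) ν) (hGA : ∀ m, ∫ θ, g θ * G m θ ∂ν = A m)
    (hG : ∀ m, ∀ᵐ θ ∂ν, 0 < g θ → 2 * (1 - G m θ) ≤ log (p (m + 1) θ) - log (p m θ))
    (hKL : Integrable (fun θ => g θ * log (g θ / p 0 θ)) ν) (M : ℕ) :
    ∑ m ∈ Finset.range M, (2 - 2 * A m) ≤ ∫ θ, g θ * log (g θ / p 0 θ) ∂ν := by
  have hi : ∀ m, Integrable (fun θ => 2 * g θ - 2 * (g θ * G m θ)) ν := fun m =>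
    (hgi.const_mul 2).sub ((hGi m).const_mul 2)
  have hval : ∀ m, ∫ θ, (2 * g θ - 2 * (g θ * G m θ)) ∂ν = 2 - 2 * A m := fun m => by
    rw [integral_sub (hgi.const_mul 2) ((hGi m).const_mul 2), integral_const_mul,
      integral_const_mul, hg1, hGA, mul_one]
  have hd : Integrable (fun θ => p M θ - g θ) ν := (hp M).integrable.sub hgi
  have hle : ∫ θ, ∑ m ∈ Finset.range M, (2 * g θ - 2 * (g θ * G m θ)) ∂ν
      ≤ ∫ θ, (g θ * log (g θ / p 0 θ) + (p M θ - g θ)) ∂ν := by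
    refine integral_mono_ae (integrable_finsetSum _ fun m _ => hi m)
      (hKL.add hd) ?_
    filter_upwards [hg0, ae_all_iff.2 hG, (hp 0).pos_of_pos, (hp M).pos_of_pos,
      (hp M).nonneg] with θ hgθ hGθ h0 hM hM0
    rcases hgθ.eq_or_lt with h | h
    · simpa [← h] using hM0
    · have hsum : ∑ m ∈ Finset.range M, 2 * (1 - G m θ) ≤ log (p M θ) - log (p 0 θ) := by
        rw [← Finset.sum_range_sub (fun m => log (p m θ))]
        exact Finset.sum_le_sum fun m _ => hGθ m h
      have hlog := Real.log_le_sub_one_of_pos (div_pos (hM h) h)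
      rw [Real.log_div (hM h).ne' h.ne'] at hlog
      have e1 : ∑ m ∈ Finset.range M, (2 * g θ - 2 * (g θ * G m θ))
          = g θ * ∑ m ∈ Finset.range M, 2 * (1 - G m θ) := by
        rw [Finset.mul_sum]
        exact Finset.sum_congr rfl fun m _ => by ring
      have e2 : g θ * (p M θ / g θ - 1) = p M θ - g θ := by field_simp
      have h1 := mul_le_mul_of_nonneg_left hsum h.le
      have h2 := mul_le_mul_of_nonneg_left hlog h.le
      rw [e2] at h2
      simp only [e1]
      rw [Real.log_div h.ne' (h0 h).ne']
      linarith
  rw [integral_finsetSum _ fun m _ => hi m, integral_add hKL hd,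
    integral_sub (hp M).integrable hgi, (hp M).integral_eq_one, hg1, sub_self, add_zero] at hle
  simpa only [hval] using hle

section Mixtures

variable {α β : Type*} [MeasurableSpace α] [MeasurableSpace β] {μ : Measure α} {ν : Measure β}
  [SFinite μ] [SFinite ν] {k : α → β → ℝ} {q : β → ℝ}

theorem integrable_kernel_mul (hk : Measurable (Function.uncurry k)) (hk0 : ∀ x θ, 0 ≤ k x θ)
    (hk1 : ∀ᵐ θ ∂ν, ∫ x, k x θ ∂μ = 1) (hqm : Measurable q) (hqi : Integrable q ν) :
    Integrable (fun z : α × β => k z.1 z.2 * q z.2) (μ.prod ν) := by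
  have hm : Measurable (fun z : α × β => k z.1 z.2 * q z.2) := hk.mul (hqm.comp measurable_snd)
  rw [integrable_prod_iff' hm.aestronglyMeasurable]
  constructor
  · filter_upwards [hk1] with θ hθ
    refine Integrable.mul_const ?_ _
    by_contra h
    rw [integral_undef h] at hθ
    exact zero_ne_one hθ
  · refine hqi.norm.congr ?_
    filter_upwards [hk1] with θ hθ
    simp only [norm_mul, Real.norm_of_nonneg (hk0 _ _), integral_mul_const, hθ, one_mul]

theorem integrable_mixture (hk : Measurable (Function.uncurry k)) (hk0 : ∀ x θ, 0 ≤ k x θ)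
    (hk1 : ∀ᵐ θ ∂ν, ∫ x, k x θ ∂μ = 1) (hqm : Measurable q) (hqi : Integrable q ν) :
    Integrable (fun x => ∫ θ, k x θ * q θ ∂ν) μ :=
  (integrable_kernel_mul hk hk0 hk1 hqm hqi).integral_prod_left

theorem integral_mixture (hk : Measurable (Function.uncurry k)) (hk0 : ∀ x θ, 0 ≤ k x θ)
    (hk1 : ∀ᵐ θ ∂ν, ∫ x, k x θ ∂μ = 1) (hqm : Measurable q) (hqi : Integrable q ν) :
    ∫ x, ∫ θ, k x θ * q θ ∂ν ∂μ = ∫ θ, q θ ∂ν := by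
  rw [integral_integral_swap (integrable_kernel_mul hk hk0 hk1 hqm hqi)]
  refine integral_congr_ae ?_
  filter_upwards [hk1] with θ hθ
  rw [integral_mul_const, hθ, one_mul]

theorem measurable_mixture (hk : Measurable (Function.uncurry k)) (hqm : Measurable q) :
    Measurable (fun x => ∫ θ, k x θ * q θ ∂ν) := by
  have hm : Measurable (fun z : α × β => k z.1 z.2 * q z.2) := hk.mul (hqm.comp measurable_snd)
  exact (hm.stronglyMeasurable.integral_prod_right (ν := ν)).measurable

theorem integrable_kernel_mul_mul_weight (hk : Measurable (Function.uncurry k))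
    (hk0 : ∀ x θ, 0 ≤ k x θ) (hk1 : ∀ᵐ θ ∂ν, ∫ x, k x θ ∂μ = 1) (hqm : Measurable q)
    (hq0 : ∀ᵐ θ ∂ν, 0 ≤ q θ) (hqi : Integrable q ν) {w : α → ℝ} (hw : Measurable w)
    (hwi : Integrable (fun x => (∫ θ, k x θ * q θ ∂ν) * w x) μ) :
    Integrable (fun z : α × β => k z.1 z.2 * q z.2 * w z.1) (μ.prod ν) := by
  have hm : Measurable (fun z : α × β => k z.1 z.2 * q z.2 * w z.1) :=
    (hk.mul (hqm.comp measurable_snd)).mul (hw.comp measurable_fst)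
  rw [integrable_prod_iff hm.aestronglyMeasurable]
  constructor
  · filter_upwards [(integrable_kernel_mul hk hk0 hk1 hqm hqi).prod_right_ae] with x hx
    exact hx.mul_const _
  · refine hwi.norm.congr (Eventually.of_forall fun x => ?_)
    simp only [norm_mul, integral_mul_const]
    rw [Real.norm_of_nonneg (mixture_nonneg hk0 hq0 x)]
    congr 1
    refine integral_congr_ae ?_
    filter_upwards [hq0] with θ hθ
    rw [Real.norm_of_nonneg (hk0 x θ), Real.norm_of_nonneg hθ]

/-- Exchanging the order of integration for a weighted mixture. -/
theorem weighted_mixture (hk : Measurable (Function.uncurry k))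
    (hk0 : ∀ x θ, 0 ≤ k x θ) (hk1 : ∀ᵐ θ ∂ν, ∫ x, k x θ ∂μ = 1) (hqm : Measurable q)
    (hq0 : ∀ᵐ θ ∂ν, 0 ≤ q θ) (hqi : Integrable q ν) {w : α → ℝ} (hw : Measurable w)
    (hwi : Integrable (fun x => (∫ θ, k x θ * q θ ∂ν) * w x) μ) :
    (∀ᵐ θ ∂ν, 0 < q θ → Integrable (fun x => k x θ * w x) μ) ∧
      Integrable (fun θ => q θ * ∫ x, k x θ * w x ∂μ) ν ∧
      ∫ θ, q θ * ∫ x, k x θ * w x ∂μ ∂ν = ∫ x, (∫ θ, k x θ * q θ ∂ν) * w x ∂μ := by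
  have hI := integrable_kernel_mul_mul_weight hk hk0 hk1 hqm hq0 hqi hw hwi
  have hrw : ∀ θ, ∫ x, k x θ * q θ * w x ∂μ = q θ * ∫ x, k x θ * w x ∂μ := fun θ => by
    rw [← integral_const_mul]
    congr 1 with x
    ring
  refine ⟨?_, ?_, ?_⟩
  · filter_upwards [hI.prod_left_ae] with θ hθ hpos
    refine (hθ.const_mul (q θ)⁻¹).congr (Eventually.of_forall fun x => ?_)
    simp only
    field_simp
  · refine hI.integral_prod_right.congr (Eventually.of_forall fun θ => ?_)
    exact hrw θ
  · simp only [← hrw, ← integral_mul_const]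
    exact (integral_integral_swap hI).symm

/-- One step of the multiplicative iteration: the new function is again a density dominating `g`,
and the logarithm of the update factor controls the Hellinger affinity of `f` and the mixture. -/
theorem IsDensityDominating.update {g : β → ℝ} {f : α → ℝ}
    (hk : Measurable (Function.uncurry k)) (hk0 : ∀ x θ, 0 ≤ k x θ)
    (hk1 : ∀ᵐ θ ∂ν, ∫ x, k x θ ∂μ = 1) (hfm : Measurable f) (hf0 : ∀ᵐ x ∂μ, 0 ≤ f x)
    (hf1 : ∫ x, f x ∂μ = 1) (hgm : Measurable g) (hg0 : ∀ᵐ θ ∂ν, 0 ≤ g θ)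
    (hg1 : ∫ θ, g θ ∂ν = 1) (hsol : ∀ᵐ x ∂μ, f x = ∫ θ, k x θ * g θ ∂ν)
    (hq : IsDensityDominating ν g q) {q' : β → ℝ} (hqm' : Measurable q')
    (hq' : ∀ᵐ θ ∂ν, q' θ = q θ * ∫ x, k x θ * f x / (∫ t, k x t * q t ∂ν) ∂μ) :
    IsDensityDominating ν g q' ∧ ∃ G : β → ℝ,
      Integrable (fun θ => g θ * G θ) ν ∧
      ∫ θ, g θ * G θ ∂ν = ∫ x, √(f x * ∫ θ, k x θ * q θ ∂ν) ∂μ ∧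
      ∀ᵐ θ ∂ν, 0 < g θ → 2 * (1 - G θ) ≤ log (q' θ) - log (q θ) := by
  have hfi : Integrable f μ := by
    by_contra h
    rw [integral_undef h] at hf1
    exact zero_ne_one hf1
  have hgi : Integrable g ν := by
    by_contra h
    rw [integral_undef h] at hg1
    exact zero_ne_one hg1
  obtain ⟨hqm, hq0, hqi, hq1, hqpos⟩ := hq
  set F : α → ℝ := fun x => ∫ θ, k x θ * q θ ∂ν with hF
  have hFm : Measurable F := measurable_mixture hk hqm
  have hF0 : ∀ x, 0 ≤ F x := mixture_nonneg hk0 hq0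
  have hFi : Integrable F μ := integrable_mixture hk hk0 hk1 hqm hqi
  have hFf : ∀ᵐ x ∂μ, F x = 0 → f x = 0 := by
    filter_upwards [hsol, (integrable_kernel_mul hk hk0 hk1 hqm hqi).prod_right_ae] with x hx hi h0
    have hnn : 0 ≤ᵐ[ν] fun θ => k x θ * q θ := by
      filter_upwards [hq0] with θ hθ using mul_nonneg (hk0 x θ) hθ
    have h1 := (integral_eq_zero_iff_of_nonneg_ae hnn hi).1 h0
    rw [hx]
    refine integral_eq_zero_of_ae ?_
    filter_upwards [h1, hqpos, hg0] with θ hθ hpos hgθ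
    rcases hgθ.eq_or_lt with h | h
    · simp [← h]
    · rcases mul_eq_zero.1 hθ with h' | h'
      · simp [h']
      · exact absurd h' (hpos h).ne'
  have hFu : (fun x => F x * (f x / F x)) =ᵐ[μ] f := by
    filter_upwards [hFf] with x hx
    by_cases h : F x = 0
    · simp [h, hx h]
    · field_simp
  obtain ⟨ha, hb, hc⟩ := weighted_mixture hk hk0 hk1 hqm hq0 hqi (hfm.div hFm)
    (hfi.congr hFu.symm)
  have hS : (fun x => (∫ θ, k x θ * g θ ∂ν) * √((f x / F x)⁻¹)) =ᵐ[μ]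
      fun x => √(f x * F x) := by
    filter_upwards [hsol, hf0] with x hx hfx
    rw [← hx, inv_div]
    rcases hfx.eq_or_lt with h | h
    · simp [← h]
    · rw [← Real.sqrt_sq hfx, ← Real.sqrt_mul (sq_nonneg _), Real.sqrt_sq hfx]
      congr 1
      field_simp
  have hSi : Integrable (fun x => √(f x * F x)) μ :=
    integrable_sqrt_mul hfm hFm hf0 (Eventually.of_forall hF0) hfi hFi
  obtain ⟨sa, sb, sc⟩ := weighted_mixture hk hk0 hk1 hgm hg0 hgi (hfm.div hFm).inv.sqrt
    (hSi.congr hS.symm)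
  have hZm : Measurable ((f ⁻¹' {0}).indicator (fun _ => (1 : ℝ))) :=
    measurable_const.indicator (hfm (measurableSet_singleton 0))
  have hZ : (fun x => (∫ θ, k x θ * g θ ∂ν) * (f ⁻¹' {0}).indicator (fun _ => (1 : ℝ)) x)
      =ᵐ[μ] fun _ => 0 := by
    filter_upwards [hsol] with x hx
    rw [← hx]
    by_cases h : f x = 0 <;> simp [h]
  obtain ⟨za, zb, zc⟩ := weighted_mixture hk hk0 hk1 hgm hg0 hgi hZm
    ((integrable_zero α ℝ μ).congr hZ.symm)
  rw [integral_congr_ae hZ, integral_zero] at zc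
  have hIn : ∀ θ x, 0 ≤ k x θ * (f ⁻¹' {0}).indicator (fun _ => (1 : ℝ)) x := fun θ x =>
    mul_nonneg (hk0 x θ) (indicator_nonneg (fun _ _ => zero_le_one) x)
  have hkz : ∀ᵐ θ ∂ν, 0 < g θ → ∀ᵐ x ∂μ, f x = 0 → k x θ = 0 := by
    have h1 := (integral_eq_zero_iff_of_nonneg_ae (by
      filter_upwards [hg0] with θ hθ using mul_nonneg hθ (integral_nonneg (hIn θ))) zb).1 zc
    filter_upwards [h1, za] with θ hθ hi hpos
    have h2 := (mul_eq_zero.1 hθ).resolve_left hpos.ne'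
    have h3 := (integral_eq_zero_iff_of_nonneg_ae
      (Eventually.of_forall (hIn θ)) (hi hpos)).1 h2
    filter_upwards [h3] with x hx hfx
    simpa [hfx] using hx
  have hu0 : ∀ᵐ x ∂μ, 0 ≤ f x / F x := by
    filter_upwards [hf0] with x hx using div_nonneg hx (hF0 x)
  have hq'' : ∀ᵐ θ ∂ν, q' θ = q θ * ∫ x, k x θ * (f x / F x) ∂μ := by
    filter_upwards [hq'] with θ hθ
    simp only [hθ, mul_div_assoc, hF]
  have hlog : ∀ᵐ θ ∂ν, 0 < g θ → 0 < ∫ x, k x θ * (f x / F x) ∂μ ∧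
      2 * (1 - ∫ x, k x θ * √((f x / F x)⁻¹) ∂μ) ≤ log (∫ x, k x θ * (f x / F x) ∂μ) := by
    filter_upwards [hk1, ha, sa, hkz, hqpos] with θ h1 h2 h3 h4 h5 hg
    refine log_integral_mul_ge (fun x => hk0 x θ) h1 hu0 ?_ (h2 (h5 hg)) (h3 hg)
    filter_upwards [h4 hg, hFf] with x hx hFx hux
    rcases div_eq_zero_iff.1 hux with h | h
    · exact hx h
    · exact hx (hFx h)
  refine ⟨⟨hqm', ?_, ?_, ?_, ?_⟩, fun θ => ∫ x, k x θ * √((f x / F x)⁻¹) ∂μ, sb, ?_, ?_⟩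
  · filter_upwards [hq'', hq0] with θ hθ h0
    rw [hθ]
    refine mul_nonneg h0 (integral_nonneg_of_ae ?_)
    filter_upwards [hu0] with x hx using mul_nonneg (hk0 x θ) hx
  · exact hb.congr (by filter_upwards [hq''] with θ hθ using hθ.symm)
  · rw [integral_congr_ae hq'', ← hf1, ← integral_congr_ae hFu]
    exact hc
  · filter_upwards [hq'', hlog, hqpos] with θ hθ hl hp hg
    rw [hθ]
    exact mul_pos (hp hg) (hl hg).1
  · rw [← integral_congr_ae hS]
    exact sc
  · filter_upwards [hq'', hlog, hqpos] with θ hθ hl hp hg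
    rw [hθ, Real.log_mul (hp hg).ne' (hl hg).1.ne']
    linarith [(hl hg).2]

end Mixtures

theorem mixture_L1_convergence
    (X Θ : Set ℝ) (hX : MeasurableSet X) (hΘ : MeasurableSet Θ)
    (k : ℝ → ℝ → ℝ)
    (hk_meas : Measurable (Function.uncurry k))
    (hk_nonneg : ∀ x θ, 0 ≤ k x θ)
    (hk_dens : ∀ θ ∈ Θ, ∫ x in X, k x θ = 1)
    (f : ℝ → ℝ) (hf_meas : Measurable f)
    (hf_nonneg : ∀ x ∈ X, 0 ≤ f x) (hf_int : ∫ x in X, f x = 1)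
    (psol : ℝ → ℝ) (hpsol_meas : Measurable psol)
    (hpsol_nonneg : ∀ θ ∈ Θ, 0 ≤ psol θ) (hpsol_int : ∫ θ in Θ, psol θ = 1)
    (hsol : ∀ᵐ x ∂(volume.restrict X), f x = mix Θ k psol x)
    (p : ℕ → ℝ → ℝ) (hp_meas : ∀ m, Measurable (p m))
    (hp0_pos : ∀ θ ∈ Θ, 0 < p 0 θ) (hp0_int : ∫ θ in Θ, p 0 θ = 1)
    (hrec : ∀ m : ℕ, ∀ θ ∈ Θ,
      p (m + 1) θ = p m θ * ∫ x in X, k x θ * f x / mix Θ k (p m) x)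
    (hfinKL : IntegrableOn (fun θ => psol θ * Real.log (psol θ / p 0 θ)) Θ) :
    Tendsto (fun m => ∫ x in X, |mix Θ k (p m) x - f x|) atTop (nhds 0) := by
  have hf0 : ∀ᵐ x ∂(volume.restrict X), 0 ≤ f x := ae_restrict_of_forall_mem hX hf_nonneg
  have hg0 : ∀ᵐ θ ∂(volume.restrict Θ), 0 ≤ psol θ := ae_restrict_of_forall_mem hΘ hpsol_nonneg
  have hk1 : ∀ᵐ θ ∂(volume.restrict Θ), ∫ x in X, k x θ = 1 :=
    ae_restrict_of_forall_mem hΘ hk_dens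
  have integrable_of_one : ∀ {S : Set ℝ} {g : ℝ → ℝ}, ∫ y in S, g y = 1 →
      Integrable g (volume.restrict S) := fun {S g} h => by
    by_contra hn
    rw [integral_undef hn] at h
    exact zero_ne_one h
  have step : ∀ m, IsDensityDominating (volume.restrict Θ) psol (p m) → _ := fun m hm =>
    hm.update hk_meas hk_nonneg hk1 hf_meas hf0 hf_int hpsol_meas hg0 hpsol_int hsol
      (hp_meas (m + 1)) (ae_restrict_of_forall_mem hΘ (hrec m))
  have hp : ∀ m, IsDensityDominating (volume.restrict Θ) psol (p m) := by
    intro m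
    induction m with
    | zero =>
      exact ⟨hp_meas 0, ae_restrict_of_forall_mem hΘ fun θ hθ => (hp0_pos θ hθ).le,
        integrable_of_one hp0_int, hp0_int,
        ae_restrict_of_forall_mem hΘ fun θ hθ _ => hp0_pos θ hθ⟩
    | succ m ih => exact (step m ih).1
  choose G hGi hGA hG using fun m => (step m (hp m)).2
  have hFm : ∀ m, Measurable (mix Θ k (p m)) := fun m => measurable_mixture hk_meas (hp_meas m)
  have hF0 : ∀ m, ∀ᵐ x ∂(volume.restrict X), 0 ≤ mix Θ k (p m) x := fun m =>
    Eventually.of_forall (mixture_nonneg hk_nonneg (hp m).nonneg)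
  have hFi : ∀ m, Integrable (mix Θ k (p m)) (volume.restrict X) := fun m =>
    integrable_mixture hk_meas hk_nonneg hk1 (hp_meas m) (hp m).integrable
  have hF1 : ∀ m, ∫ x in X, mix Θ k (p m) x = 1 := fun m =>
    (integral_mixture hk_meas hk_nonneg hk1 (hp_meas m) (hp m).integrable).trans
      (hp m).integral_eq_one
  have hfi := integrable_of_one hf_int
  set H : ℕ → ℝ := fun m => 2 - 2 * ∫ x in X, √(f x * mix Θ k (p m) x) with hH
  have hH0 : ∀ m, 0 ≤ H m := fun m => by
    have := integral_sqrt_mul_le_one hf_meas (hFm m) hf0 (hF0 m) hfi (hFi m) hf_int (hF1 m)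
    simp only [hH]
    linarith
  have hHt : Tendsto H atTop (nhds 0) :=
    (summable_of_sum_range_le hH0 (sum_hellinger_le hg0 (integrable_of_one hpsol_int) hpsol_int
      hp hGi hGA hG hfinKL)).tendsto_atTop_zero
  rw [Metric.tendsto_atTop]
  intro ε hε
  obtain ⟨N, hN⟩ := Metric.tendsto_atTop.1 hHt (ε ^ 2 / 8) (by positivity)
  refine ⟨N, fun n hn => ?_⟩
  have h1 := hN n hn
  rw [Real.dist_eq, sub_zero, abs_of_nonneg (hH0 n)] at h1
  rw [Real.dist_eq, sub_zero, abs_of_nonneg (integral_nonneg fun x => abs_nonneg _)]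
  have h2 := integral_abs_sub_le_hellinger hf_meas (hFm n) hf0 (hF0 n) hfi (hFi n) hf_int (hF1 n)
    (show 0 < ε / 4 by positivity)
  have h3 : H n / (2 * (ε / 4)) < ε / 4 := by
    rw [div_lt_iff₀ (by positivity)]
    nlinarith
  have h4 : ∫ x in X, |mix Θ k (p n) x - f x| ≤ H n / (2 * (ε / 4)) + 2 * (ε / 4) := h2
  linarith
end

section
/- Let a, b > 0, let h : (0,∞) → ℝ be measurable, and let p be a probability density on (0,∞). For θ > 0 let k(x,θ) denote the density of the normal distribution with mean b h(θ)/θ and variance 1/θ restricted (renormalized) to (0,∞), i.e. k(x,θ) = √θ φ(√θ(x − b h(θ)/θ)) / Φ(b h(θ)/√θ) for x > 0, and define p̃ by √θ · p̃(θ) = a √(2π) e^{b² h(θ)²/(2θ)} Φ(b h(θ)/√θ) p(θ). Then ∫_0^∞ exp{x a + x b h(θ) − x² θ / 2} p(θ) dθ = 1 for all x > 0 if and only if ∫_0^∞ k(x,θ) p̃(θ) dθ = a e^{−a x} for all x > 0. -/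
open MeasureTheory Real Set

theorem setIntegral_Iic_gaussian_pos (y : ℝ) :
    0 < ∫ t in Iic y, Real.exp (-t ^ 2 / 2) / Real.sqrt (2 * π) := by
  have hint : Integrable (fun t : ℝ => Real.exp (-t ^ 2 / 2) / Real.sqrt (2 * π)) := by
    have hexp := (integrable_exp_neg_mul_sq (b := 1 / 2) (by norm_num)).div_const
      (Real.sqrt (2 * π))
    convert hexp using 4
    ring
  rw [setIntegral_pos_iff_support_of_nonneg_ae
    (Filter.Eventually.of_forall fun t => by positivity) hint.integrableOn]
  have hsupp : Function.support (fun t : ℝ => Real.exp (-t ^ 2 / 2) / Real.sqrt (2 * π)) =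
      univ := by
    ext t
    have hpos : 0 < Real.exp (-t ^ 2 / 2) / Real.sqrt (2 * π) := by positivity
    simpa using hpos.ne'
  rw [hsupp, univ_inter, Real.volume_Iic]
  exact ENNReal.zero_lt_top

theorem first_passage_fredholm_equivalence
    (a b : ℝ) (ha : 0 < a) (hb : 0 < b)
    (h : ℝ → ℝ) (hh_meas : Measurable h)
    (p : ℝ → ℝ) (hp_meas : Measurable p)
    (hp_nonneg : ∀ θ ∈ Ioi (0:ℝ), 0 ≤ p θ) (hp_int : ∫ θ in Ioi (0:ℝ), p θ = 1)
    (Φ : ℝ → ℝ)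
    (hΦ : ∀ y, Φ y = ∫ t in Iic y, Real.exp (-t ^ 2 / 2) / Real.sqrt (2 * π))
    (k : ℝ → ℝ → ℝ)
    (hk : ∀ x θ, k x θ =
      Real.sqrt θ * (Real.exp (-(Real.sqrt θ * (x - b * h θ / θ)) ^ 2 / 2) /
        Real.sqrt (2 * π)) / Φ (b * h θ / Real.sqrt θ))
    (pt : ℝ → ℝ) (hpt_meas : Measurable pt)
    (hpt : ∀ θ ∈ Ioi (0:ℝ), Real.sqrt θ * pt θ =
      a * Real.sqrt (2 * π) * Real.exp (b ^ 2 * h θ ^ 2 / (2 * θ)) *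
        Φ (b * h θ / Real.sqrt θ) * p θ) :
    (∀ x > (0:ℝ), ∫ θ in Ioi (0:ℝ),
        Real.exp (x * a + x * b * h θ - x ^ 2 * θ / 2) * p θ = 1) ↔
      (∀ x > (0:ℝ), ∫ θ in Ioi (0:ℝ), k x θ * pt θ = a * Real.exp (-a * x)) := by
  have hpointwise : ∀ x, ∀ θ ∈ Ioi (0 : ℝ), k x θ * pt θ = a * Real.exp (-a * x) *
      (Real.exp (x * a + x * b * h θ - x ^ 2 * θ / 2) * p θ) := by
    intro x θ hθ
    have hθ_pos : 0 < θ := hθ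
    have hΦ_pos : 0 < Φ (b * h θ / Real.sqrt θ) := by
      rw [hΦ]
      exact setIntegral_Iic_gaussian_pos _
    have hπ : 0 < Real.sqrt (2 * π) := by positivity
    have hexp : Real.exp (-(Real.sqrt θ * (x - b * h θ / θ)) ^ 2 / 2) *
        Real.exp (b ^ 2 * h θ ^ 2 / (2 * θ)) =
        Real.exp (-a * x) * Real.exp (x * a + x * b * h θ - x ^ 2 * θ / 2) := by
      rw [← Real.exp_add, ← Real.exp_add, mul_pow, Real.sq_sqrt hθ_pos.le]
      congr 1
      field_simp
      ring
    calc k x θ * pt θ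
        = Real.exp (-(Real.sqrt θ * (x - b * h θ / θ)) ^ 2 / 2) / Real.sqrt (2 * π) /
            Φ (b * h θ / Real.sqrt θ) * (Real.sqrt θ * pt θ) := by rw [hk]; ring
      _ = a * (Real.exp (-(Real.sqrt θ * (x - b * h θ / θ)) ^ 2 / 2) *
            Real.exp (b ^ 2 * h θ ^ 2 / (2 * θ))) * p θ := by
          rw [hpt θ hθ]
          generalize Φ (b * h θ / Real.sqrt θ) = c at hΦ_pos ⊢
          generalize Real.sqrt (2 * π) = d at hπ ⊢
          generalize Real.exp (-(Real.sqrt θ * (x - b * h θ / θ)) ^ 2 / 2) = u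
          generalize Real.exp (b ^ 2 * h θ ^ 2 / (2 * θ)) = v
          field_simp
      _ = _ := by rw [hexp]; ring
  refine forall₂_congr fun x _ => ?_
  rw [setIntegral_congr_fun measurableSet_Ioi (hpointwise x), integral_const_mul]
  have hpos : a * Real.exp (-a * x) ≠ 0 := by positivity
  exact (mul_eq_left₀ hpos).symm
end

section
/- Suppose Θ ⊆ ℝ is compact, θ ↦ k(x,θ) is continuous for each x ∈ 𝕏, and the map P ↦ D(f, f_P) over probability measures P on Θ, with f_P(x) = ∫_Θ k(x,θ) dP(θ), attains its infimum at a unique probability measure P*. Let (p_m) be generated by the iterative scheme from an initial probability density p₀ > 0 on Θ, let P_m be the probability measure with density p_m, and suppose D(f, f_m) → inf_P D(f, f_P) as m → ∞ (the conclusion of the convergence theorem). Then P_m converges weakly to P*. -/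
open MeasureTheory Real Filter Set

noncomputable def mixKLInf (X Θ : Set ℝ) (k : ℝ → ℝ → ℝ) (f : ℝ → ℝ) : ℝ :=
  sInf {d : ℝ | ∃ P : Measure ℝ, IsProbabilityMeasure P ∧ P Θᶜ = 0 ∧
    d = KL X f (fun x => ∫ θ, k x θ ∂P)}

/-- The Kullback–Leibler integrand, shifted by the reference density, is nonnegative; this includes
the convention `log (a / 0) = 0`. -/
lemma mul_log_div_add_nonneg {a b : ℝ} (ha : 0 ≤ a) (hb : 0 ≤ b) :
    0 ≤ a * Real.log (a / b) + b := by
  rcases hb.eq_or_lt with rfl | hb'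
  · simp
  rcases ha.eq_or_lt with rfl | ha'
  · simpa using hb
  have h1 := Real.one_sub_inv_le_log_of_pos (div_pos ha' hb')
  have h2 : a * (1 - (a / b)⁻¹) = a - b := by field_simp
  nlinarith [mul_le_mul_of_nonneg_left h1 ha]

/-- Fatou's lemma for Kullback–Leibler integrals along a pointwise convergent sequence of
densities. -/
lemma integral_mul_log_div_le_of_tendsto {α : Type*} [MeasurableSpace α] {μ : Measure α}
    {f h : α → ℝ} {u : ℕ → α → ℝ} {c : ℝ} (hf_meas : AEMeasurable f μ) (hf : ∀ᵐ x ∂μ, 0 ≤ f x)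
    (hu_meas : ∀ n, Measurable (u n)) (hu : ∀ n x, 0 ≤ u n x)
    (hu_int : ∀ n, Integrable (u n) μ) (hu_one : ∀ n, ∫ x, u n x ∂μ = 1)
    (hh_meas : Measurable h) (hh : ∀ x, 0 ≤ h x)
    (hh_int : Integrable h μ) (hh_one : ∫ x, h x ∂μ = 1)
    (hlim : ∀ x, Tendsto (fun n => u n x) atTop (nhds (h x)))
    (hint : ∀ n, Integrable (fun x => f x * Real.log (f x / u n x)) μ)
    (hc : Tendsto (fun n => ∫ x, f x * Real.log (f x / u n x) ∂μ) atTop (nhds c)) :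
    ∫ x, f x * Real.log (f x / h x) ∂μ ≤ c := by
  have hmeas : ∀ v : α → ℝ, Measurable v →
      AEMeasurable (fun x => f x * Real.log (f x / v x) + v x) μ := fun v hv =>
    (hf_meas.mul (Real.measurable_log.comp_aemeasurable (hf_meas.div hv.aemeasurable))).add
      hv.aemeasurable
  have hFn : ∀ n, ∫⁻ x, ENNReal.ofReal (f x * Real.log (f x / u n x) + u n x) ∂μ
      = ENNReal.ofReal (∫ x, f x * Real.log (f x / u n x) ∂μ + 1) := by
    intro n
    rw [← hu_one n, ← integral_add (hint n) (hu_int n)]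
    refine (ofReal_integral_eq_lintegral_ofReal ((hint n).add (hu_int n)) ?_).symm
    filter_upwards [hf] with x hx using mul_log_div_add_nonneg hx (hu n x)
  have hc' : Tendsto (fun n => ∫⁻ x, ENNReal.ofReal (f x * Real.log (f x / u n x) + u n x) ∂μ)
      atTop (nhds (ENNReal.ofReal (c + 1))) := by
    simp_rw [hFn]
    exact ENNReal.tendsto_ofReal (hc.add_const 1)
  have hpt : ∀ᵐ x ∂μ, ENNReal.ofReal (f x * Real.log (f x / h x) + h x) ≤
      liminf (fun n => ENNReal.ofReal (f x * Real.log (f x / u n x) + u n x)) atTop := by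
    filter_upwards [hf] with x hx
    rcases (hh x).eq_or_lt with h0 | hpos
    · simp [← h0]
    rcases hx.eq_or_lt with f0 | fpos
    · simpa [← f0] using (ENNReal.tendsto_ofReal (hlim x)).liminf_eq.ge
    · refine (ENNReal.tendsto_ofReal (Tendsto.add (Tendsto.const_mul _ ?_) (hlim x))).liminf_eq.ge
      exact (tendsto_const_nhds.div (hlim x) hpos.ne').log (div_pos fpos hpos).ne'
  have hle : ∫⁻ x, ENNReal.ofReal (f x * Real.log (f x / h x) + h x) ∂μ
      ≤ ENNReal.ofReal (c + 1) :=
    calc _ ≤ _ := lintegral_mono_ae hpt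
      _ ≤ _ := lintegral_liminf_le' fun n => (hmeas _ (hu_meas n)).ennreal_ofReal
      _ = _ := hc'.liminf_eq
  have hnn : 0 ≤ᵐ[μ] fun x => f x * Real.log (f x / h x) + h x := by
    filter_upwards [hf] with x hx using mul_log_div_add_nonneg hx (hh x)
  have hFint : Integrable (fun x => f x * Real.log (f x / h x) + h x) μ :=
    ⟨(hmeas h hh_meas).aestronglyMeasurable,
      (hasFiniteIntegral_iff_ofReal hnn).2 (hle.trans_lt ENNReal.ofReal_lt_top)⟩
  have hKint : Integrable (fun x => f x * Real.log (f x / h x)) μ := by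
    simpa [Pi.sub_def] using hFint.sub hh_int
  have hc1 : 0 ≤ c + 1 := by
    refine ge_of_tendsto' (hc.add_const 1) fun n => ?_
    rw [← hu_one n, ← integral_add (hint n) (hu_int n)]
    refine integral_nonneg_of_ae ?_
    filter_upwards [hf] with x hx using mul_log_div_add_nonneg hx (hu n x)
  rw [← ofReal_integral_eq_lintegral_ofReal hFint hnn, ENNReal.ofReal_le_ofReal_iff hc1,
    integral_add hKint hh_int, hh_one] at hle
  linarith

/-- Kullback–Leibler integrals against probability densities are at least `-1`. -/
lemma neg_one_le_integral_mul_log_div {α : Type*} [MeasurableSpace α] {μ : Measure α}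
    {f h : α → ℝ} (hf : ∀ᵐ x ∂μ, 0 ≤ f x) (hh : ∀ x, 0 ≤ h x)
    (hh_int : Integrable h μ) (hh_one : ∫ x, h x ∂μ = 1) :
    -1 ≤ ∫ x, f x * Real.log (f x / h x) ∂μ := by
  by_cases hK : Integrable (fun x => f x * Real.log (f x / h x)) μ
  · have : 0 ≤ ∫ x, (f x * Real.log (f x / h x) + h x) ∂μ := by
      refine integral_nonneg_of_ae ?_
      filter_upwards [hf] with x hx using mul_log_div_add_nonneg hx (hh x)
    rw [integral_add hK hh_int, hh_one] at this
    linarith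
  · rw [integral_undef hK]
    norm_num

lemma integrable_uncurry_kernel {X Θ : Set ℝ} {k : ℝ → ℝ → ℝ}
    (hk_meas : Measurable (Function.uncurry k)) (hk_nonneg : ∀ x θ, 0 ≤ k x θ)
    (hk_dens : ∀ θ ∈ Θ, ∫ x in X, k x θ = 1)
    (P : Measure ℝ) [IsProbabilityMeasure P] (hP : P Θᶜ = 0) :
    Integrable (Function.uncurry k) ((volume.restrict X).prod P) := by
  have hΘ : ∀ᵐ θ ∂P, θ ∈ Θ := hP
  refine (integrable_prod_iff' hk_meas.aestronglyMeasurable).2 ⟨?_, ?_⟩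
  · filter_upwards [hΘ] with θ hθ
    exact Integrable.of_integral_ne_zero (by simp [Function.uncurry, hk_dens θ hθ])
  · refine (integrable_const (1 : ℝ)).congr ?_
    filter_upwards [hΘ] with θ hθ
    simp [Function.uncurry, abs_of_nonneg (hk_nonneg _ _), hk_dens θ hθ]

lemma setIntegral_mixture_eq_one {X Θ : Set ℝ} {k : ℝ → ℝ → ℝ}
    (hk_meas : Measurable (Function.uncurry k)) (hk_nonneg : ∀ x θ, 0 ≤ k x θ)
    (hk_dens : ∀ θ ∈ Θ, ∫ x in X, k x θ = 1)
    (P : Measure ℝ) [IsProbabilityMeasure P] (hP : P Θᶜ = 0) :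
    ∫ x in X, ∫ θ, k x θ ∂P = 1 := by
  have hΘ : ∀ᵐ θ ∂P, θ ∈ Θ := hP
  rw [integral_integral_swap (integrable_uncurry_kernel hk_meas hk_nonneg hk_dens P hP)]
  calc _ = ∫ _, (1 : ℝ) ∂P :=
      integral_congr_ae (by filter_upwards [hΘ] with θ hθ using hk_dens θ hθ)
    _ = 1 := by simp

/-- Weak convergence of probability measures carried by a compact set tests against functions that
are merely continuous on that set. -/
lemma tendsto_integral_of_continuousOn {Θ : Set ℝ} (hΘ : IsCompact Θ) {φ : ℝ → ℝ}
    (hφ : ContinuousOn φ Θ) {P : ℕ → ProbabilityMeasure ℝ} {Q : ProbabilityMeasure ℝ}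
    (hP : ∀ n, (P n : Measure ℝ) Θᶜ = 0) (hQ : (Q : Measure ℝ) Θᶜ = 0)
    (hlim : Tendsto P atTop (nhds Q)) :
    Tendsto (fun n => ∫ θ, φ θ ∂(P n : Measure ℝ)) atTop (nhds (∫ θ, φ θ ∂(Q : Measure ℝ))) := by
  have : CompactSpace Θ := isCompact_iff_compactSpace.1 hΘ
  obtain ⟨g, -, hg⟩ := BoundedContinuousFunction.exists_norm_eq_domRestrict_eq_of_closed
    (BoundedContinuousFunction.mkOfCompact ⟨Θ.domRestrict φ, hφ.domRestrict⟩) hΘ.isClosed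
  have hgφ : ∀ θ ∈ Θ, g θ = φ θ := fun θ hθ => by
    exact DFunLike.congr_fun hg ⟨θ, hθ⟩
  have hcongr : ∀ ν : Measure ℝ, ν Θᶜ = 0 → ∫ θ, g θ ∂ν = ∫ θ, φ θ ∂ν := fun ν hν => by
    have hΘ' : ∀ᵐ θ ∂ν, θ ∈ Θ := hν
    exact integral_congr_ae (by filter_upwards [hΘ'] with θ hθ using hgφ θ hθ)
  simpa only [hcongr _ (hP _), hcongr _ hQ] using
    ProbabilityMeasure.tendsto_iff_forall_integral_tendsto.1 hlim g

lemma isCompact_setOf_probabilityMeasure_compl_eq_zero {Θ : Set ℝ} (hΘ : IsCompact Θ) :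
    IsCompact {P : ProbabilityMeasure ℝ | (P : Measure ℝ) Θᶜ = 0} := by
  have := isCompact_setOfPred_probabilityMeasure_mass_eq_compl_isCompact_le
    (u := fun _ => 0) (K := fun _ => Θ) tendsto_const_nhds (fun _ => hΘ) (.inl inferInstance)
  simpa using this

/-- A sequence of mixing measures whose Kullback–Leibler values tend to the infimum converges
weakly to the unique minimizer. -/
lemma tendsto_unique_minimizer {X Θ : Set ℝ} (hX : MeasurableSet X) (hΘcomp : IsCompact Θ)
    {k : ℝ → ℝ → ℝ} (hk_meas : Measurable (Function.uncurry k)) (hk_nonneg : ∀ x θ, 0 ≤ k x θ)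
    (hk_dens : ∀ θ ∈ Θ, ∫ x in X, k x θ = 1)
    (hk_cont : ∀ x, ContinuousOn (fun θ => k x θ) Θ)
    {f : ℝ → ℝ} (hf_meas : Measurable f) (hf_nonneg : ∀ x ∈ X, 0 ≤ f x)
    {Pstar : ProbabilityMeasure ℝ}
    (hPstar_uniq : ∀ Q : Measure ℝ, IsProbabilityMeasure Q → Q Θᶜ = 0 →
      KL X f (fun x => ∫ θ, k x θ ∂Q) = mixKLInf X Θ k f → Q = Pstar)
    {P : ℕ → ProbabilityMeasure ℝ} (hP : ∀ m, (P m : Measure ℝ) Θᶜ = 0)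
    (hconv : Tendsto (fun m => KL X f (fun x => ∫ θ, k x θ ∂(P m : Measure ℝ))) atTop
      (nhds (mixKLInf X Θ k f))) :
    Tendsto P atTop (nhds Pstar) := by
  have hf : ∀ᵐ x ∂volume.restrict X, 0 ≤ f x := by
    filter_upwards [ae_restrict_mem hX] with x hx using hf_nonneg x hx
  have hmeas : ∀ Q : ProbabilityMeasure ℝ, Measurable fun x => ∫ θ, k x θ ∂(Q : Measure ℝ) :=
    fun Q => hk_meas.stronglyMeasurable.integral_prod_right.measurable
  have hnonneg : ∀ (Q : Measure ℝ) x, 0 ≤ ∫ θ, k x θ ∂Q :=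
    fun Q x => integral_nonneg (hk_nonneg x)
  have hint : ∀ Q : Measure ℝ, IsProbabilityMeasure Q → Q Θᶜ = 0 →
      IntegrableOn (fun x => ∫ θ, k x θ ∂Q) X := fun Q _ hQ =>
    (integrable_uncurry_kernel hk_meas hk_nonneg hk_dens Q hQ).integral_prod_left
  have hone : ∀ Q : Measure ℝ, IsProbabilityMeasure Q → Q Θᶜ = 0 →
      ∫ x in X, ∫ θ, k x θ ∂Q = 1 := fun Q _ hQ =>
    setIntegral_mixture_eq_one hk_meas hk_nonneg hk_dens Q hQ
  have hinf : ∀ Q : ProbabilityMeasure ℝ, (Q : Measure ℝ) Θᶜ = 0 →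
      mixKLInf X Θ k f ≤ KL X f (fun x => ∫ θ, k x θ ∂(Q : Measure ℝ)) := by
    intro Q hQ
    refine csInf_le ⟨-1, ?_⟩ ⟨Q, inferInstance, hQ, rfl⟩
    rintro _ ⟨R, hR, hR0, rfl⟩
    exact neg_one_le_integral_mul_log_div hf (hnonneg R) (hint R hR hR0) (hone R hR hR0)
  refine tendsto_of_subseq_tendsto fun ns hns => ?_
  have hconv' := hconv.comp hns
  by_cases hfreq : ∃ᶠ n in atTop, ¬ IntegrableOn
      (fun x => f x * Real.log (f x / ∫ θ, k x θ ∂(P (ns n) : Measure ℝ))) X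
  · obtain ⟨ms, hms, hbad⟩ := extraction_of_frequently_atTop hfreq
    have hzero : ∀ n, KL X f (fun x => ∫ θ, k x θ ∂(P (ns (ms n)) : Measure ℝ)) = 0 :=
      fun n => integral_undef (hbad n)
    have hinf0 : mixKLInf X Θ k f = 0 := by
      refine tendsto_nhds_unique (hconv'.comp hms.tendsto_atTop) ?_
      simp [Function.comp_def, hzero]
    refine ⟨ms, tendsto_const_nhds.congr fun n => Subtype.ext ?_⟩
    exact (hPstar_uniq _ inferInstance (hP _) ((hzero n).trans hinf0.symm)).symm
  · rw [not_frequently] at hfreq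
    obtain ⟨N, hN⟩ := eventually_atTop.1 hfreq
    obtain ⟨Q, hQ, φ, hφ, hlim⟩ :=
      (isCompact_setOf_probabilityMeasure_compl_eq_zero hΘcomp).tendsto_subseq
        (x := fun n => P (ns (n + N))) fun n => hP _
    refine ⟨fun n => φ n + N, ?_⟩
    have hle : KL X f (fun x => ∫ θ, k x θ ∂(Q : Measure ℝ)) ≤ mixKLInf X Θ k f := by
      refine integral_mul_log_div_le_of_tendsto
        (u := fun n x => ∫ θ, k x θ ∂(P (ns (φ n + N)) : Measure ℝ))
        hf_meas.aemeasurable hf (fun n => hmeas _)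
        (fun n => hnonneg _) (fun n => hint _ inferInstance (hP _))
        (fun n => hone _ inferInstance (hP _)) (hmeas Q) (hnonneg _) (hint _ inferInstance hQ)
        (hone _ inferInstance hQ)
        (fun x => tendsto_integral_of_continuousOn hΘcomp (hk_cont x) (fun n => hP _) hQ hlim)
        (fun n => not_not.1 (hN _ (Nat.le_add_left _ _))) ?_
      exact hconv'.comp ((tendsto_add_atTop_nat N).comp hφ.tendsto_atTop)
    have hQeq : Q = Pstar :=
      Subtype.ext (hPstar_uniq Q inferInstance hQ (hle.antisymm (hinf Q hQ)))
    exact hQeq ▸ hlim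

/-- Integration against a density on `Θ` is integration against the measure it defines. -/
lemma integral_withDensity_ofReal_restrict {Θ : Set ℝ} (hΘ : MeasurableSet Θ) {q : ℝ → ℝ}
    (hq_meas : Measurable q) (hq : ∀ θ ∈ Θ, 0 ≤ q θ) (g : ℝ → ℝ) :
    ∫ θ, g θ ∂(volume.restrict Θ).withDensity (fun θ => ENNReal.ofReal (q θ))
      = ∫ θ in Θ, g θ * q θ := by
  rw [integral_withDensity_eq_integral_toReal_smul hq_meas.ennreal_ofReal (by simp)]
  refine setIntegral_congr_fun hΘ fun θ hθ => ?_
  simp [ENNReal.toReal_ofReal (hq θ hθ), mul_comm]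

lemma isProbabilityMeasure_withDensity_ofReal_restrict {Θ : Set ℝ} (hΘ : MeasurableSet Θ)
    {q : ℝ → ℝ} (hq : ∀ θ ∈ Θ, 0 ≤ q θ) (hq_int : ∫ θ in Θ, q θ = 1) :
    IsProbabilityMeasure
      ((volume.restrict Θ).withDensity fun θ => ENNReal.ofReal (q θ)) := by
  refine ⟨?_⟩
  rw [withDensity_apply _ MeasurableSet.univ, Measure.restrict_univ,
    ← ofReal_integral_eq_lintegral_ofReal, hq_int, ENNReal.ofReal_one]
  · exact Integrable.of_integral_ne_zero (by simp [hq_int])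
  · filter_upwards [ae_restrict_mem hΘ] with θ hθ using hq θ hθ

theorem iterates_weak_convergence_to_unique_minimizer
    (X Θ : Set ℝ) (hX : MeasurableSet X) (hΘ : MeasurableSet Θ)
    (hΘcomp : IsCompact Θ)
    (k : ℝ → ℝ → ℝ)
    (hk_meas : Measurable (Function.uncurry k))
    (hk_nonneg : ∀ x θ, 0 ≤ k x θ)
    (hk_dens : ∀ θ ∈ Θ, ∫ x in X, k x θ = 1)
    (hk_cont : ∀ x, ContinuousOn (fun θ => k x θ) Θ)
    (f : ℝ → ℝ) (hf_meas : Measurable f)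
    (hf_nonneg : ∀ x ∈ X, 0 ≤ f x) (hf_int : ∫ x in X, f x = 1)
    (Pstar : Measure ℝ) (hPstar_prob : IsProbabilityMeasure Pstar)
    (hPstar_supp : Pstar Θᶜ = 0)
    (hPstar_min : KL X f (fun x => ∫ θ, k x θ ∂Pstar) = mixKLInf X Θ k f)
    (hPstar_uniq : ∀ Q : Measure ℝ, IsProbabilityMeasure Q → Q Θᶜ = 0 →
      KL X f (fun x => ∫ θ, k x θ ∂Q) = mixKLInf X Θ k f → Q = Pstar)
    (p : ℕ → ℝ → ℝ) (hp_meas : ∀ m, Measurable (p m))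
    (hp0_pos : ∀ θ ∈ Θ, 0 < p 0 θ) (hp0_int : ∫ θ in Θ, p 0 θ = 1)
    (hrec : ∀ m : ℕ, ∀ θ ∈ Θ,
      p (m + 1) θ = p m θ * ∫ x in X, k x θ * f x / mix Θ k (p m) x)
    (hp_nonneg : ∀ m, ∀ θ ∈ Θ, 0 ≤ p m θ)
    (hp_int : ∀ m, ∫ θ in Θ, p m θ = 1)
    (hconv : Tendsto (fun m => KL X f (mix Θ k (p m))) atTop
      (nhds (mixKLInf X Θ k f))) :
    ∀ g : BoundedContinuousFunction ℝ ℝ,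
      Tendsto (fun m => ∫ θ in Θ, g θ * p m θ) atTop (nhds (∫ θ, g θ ∂Pstar)) := by
  let P : ℕ → ProbabilityMeasure ℝ := fun m =>
    ⟨(volume.restrict Θ).withDensity fun θ => ENNReal.ofReal (p m θ),
      isProbabilityMeasure_withDensity_ofReal_restrict hΘ (hp_nonneg m) (hp_int m)⟩
  have hPint : ∀ m (g : ℝ → ℝ), ∫ θ, g θ ∂(P m : Measure ℝ) = ∫ θ in Θ, g θ * p m θ :=
    fun m g => integral_withDensity_ofReal_restrict hΘ (hp_meas m) (hp_nonneg m) g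
  have hP : ∀ m, (P m : Measure ℝ) Θᶜ = 0 := fun m =>
    withDensity_absolutelyContinuous _ _ (by simp [Measure.restrict_apply hΘ.compl])
  have hlim : Tendsto P atTop (nhds ⟨Pstar, hPstar_prob⟩) := by
    refine tendsto_unique_minimizer (Pstar := ⟨Pstar, hPstar_prob⟩) hX hΘcomp hk_meas
      hk_nonneg hk_dens hk_cont hf_meas hf_nonneg hPstar_uniq hP ?_
    simp_rw [hPint]
    exact hconv
  intro g
  have := ProbabilityMeasure.tendsto_iff_forall_integral_tendsto.1 hlim g
  simp_rw [hPint] at this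
  exact this
end
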